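/- Let E be a real inner product space, n ≥ 1, m ≥ 1, let g₁,…,gₙ ∈ E, a ∈ E, and α ∈ ℝ with α ≠ 0. For a probability vector p with pᵢ > 0 for all i, define the batch estimator ḡ_p(i₁,…,i_m) = (1/m)·∑_{k=1}^{m} (1/(n·p_{i_k}))·g_{i_k} and the expected progress Δ(p) = ‖a‖² − ∑_{(i₁,…,i_m)∈{1,…,n}^m} (∏_{k=1}^{m} p_{i_k}) · ‖a + α·ḡ_p(i₁,…,i_m)‖². Then for any two probability vectors p, q with all entries positive, Δ(p) ≥ Δ(q) if and only if ∑_{i=1}^{n} (1/pᵢ)·‖gᵢ‖² ≤ ∑_{i=1}^{n} (1/qᵢ)·‖gᵢ‖²; that is, maximizing the expected training progress over sampling distributions is equivalent to minimizing the variance term ∑_{i=1}^{n} (1/pᵢ)·‖gᵢ‖². -/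

import Mathlib

open Finset

/-- Second moment of a shifted sum of `m` i.i.d. draws from a finitely supported distribution. -/
theorem sum_prod_mul_norm_add_sum_sq
    {E ι : Type*} [NormedAddCommGroup E] [InnerProductSpace ℝ E] [Fintype ι]
    (p : ι → ℝ) (hp : ∑ i, p i = 1) (x : ι → E) (m : ℕ) (a : E) :
    ∑ I : Fin m → ι, (∏ k, p (I k)) * ‖a + ∑ k, x (I k)‖ ^ 2 =
      ‖a‖ ^ 2 + 2 * m * inner ℝ a (∑ i, p i • x i) + m * (m - 1) * ‖∑ i, p i • x i‖ ^ 2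
        + m * ∑ i, p i * ‖x i‖ ^ 2 := by
  induction m generalizing a with
  | zero => simp
  | succ m ih =>
    rw [← (Fin.consEquiv fun _ : Fin (m + 1) => ι).sum_comp, Fintype.sum_prod_type]
    have step (i : ι) : ∑ I : Fin m → ι,
        (∏ k, p (Fin.consEquiv (fun _ : Fin (m + 1) => ι) (i, I) k)) *
          ‖a + ∑ k, x (Fin.consEquiv (fun _ : Fin (m + 1) => ι) (i, I) k)‖ ^ 2 =
        p i * ∑ I : Fin m → ι, (∏ k, p (I k)) * ‖(a + x i) + ∑ k, x (I k)‖ ^ 2 := by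
      simp [Fin.consEquiv, Fin.prod_univ_succ, Fin.sum_univ_succ, mul_sum, mul_assoc, add_assoc]
    simp_rw [step, ih]
    set X := ∑ i, p i • x i with hX
    have inner_mean (b : E) : ∑ i, p i * inner ℝ b (x i) = inner ℝ b X := by
      simp [hX, inner_sum, inner_smul_right]
    have expand (i : ι) : p i * (‖a + x i‖ ^ 2 + 2 * m * inner ℝ (a + x i) X
          + m * (m - 1) * ‖X‖ ^ 2 + m * ∑ j, p j * ‖x j‖ ^ 2) =
        p i * (‖a‖ ^ 2 + 2 * m * inner ℝ a X + m * (m - 1) * ‖X‖ ^ 2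
          + m * ∑ j, p j * ‖x j‖ ^ 2)
        + 2 * (p i * inner ℝ a (x i)) + 2 * m * (p i * inner ℝ X (x i))
        + p i * ‖x i‖ ^ 2 := by
      rw [norm_add_sq_real, inner_add_left, real_inner_comm X (x i)]
      ring
    simp_rw [expand, sum_add_distrib, ← mul_sum, ← sum_mul, inner_mean, hp,
      real_inner_self_eq_norm_sq]
    push_cast
    ring

open Finset

/-- Maximizing the expected training progress over fully supported sampling
distributions is equivalent to minimizing the variance term ∑ᵢ (1/pᵢ)‖gᵢ‖². -/
theorem progress_ge_iff_variance_term_le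
    {E : Type*} [NormedAddCommGroup E] [InnerProductSpace ℝ E]
    (n m : ℕ) (hn : 1 ≤ n) (hm : 1 ≤ m)
    (g : Fin n → E) (a : E) (α : ℝ) (hα : α ≠ 0)
    (gbar : (Fin n → ℝ) → (Fin m → Fin n) → E)
    (hgbar : ∀ (p : Fin n → ℝ) (I : Fin m → Fin n),
      gbar p I = ((m : ℝ))⁻¹ • ∑ k : Fin m, (((n : ℝ) * p (I k))⁻¹) • g (I k))
    (Δ : (Fin n → ℝ) → ℝ)
    (hΔ : ∀ p : Fin n → ℝ,
      Δ p = ‖a‖ ^ 2 - ∑ I : Fin m → Fin n, (∏ k : Fin m, p (I k)) * ‖a + α • gbar p I‖ ^ 2)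
    (p : Fin n → ℝ) (hp0 : ∀ i, 0 < p i) (hp1 : ∑ i, p i = 1)
    (q : Fin n → ℝ) (hq0 : ∀ i, 0 < q i) (hq1 : ∑ i, q i = 1) :
    Δ q ≤ Δ p ↔ ∑ i, (p i)⁻¹ * ‖g i‖ ^ 2 ≤ ∑ i, (q i)⁻¹ * ‖g i‖ ^ 2 := by
  have hn' : (n : ℝ) ≠ 0 := by positivity
  have hm' : (0 : ℝ) < m := by positivity
  set G := ∑ i, g i with hG
  have progress_eq (r : Fin n → ℝ) (hr0 : ∀ i, 0 < r i) (hr1 : ∑ i, r i = 1) :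
      Δ r = -(2 * m * inner ℝ a ((α / (m * n)) • G)
        + m * (m - 1) * ‖(α / (m * n)) • G‖ ^ 2)
        - m * (α / (m * n)) ^ 2 * ∑ i, (r i)⁻¹ * ‖g i‖ ^ 2 := by
    have smul_gbar (I : Fin m → Fin n) :
        α • gbar r I = ∑ k, (α / (m * n) * (r (I k))⁻¹) • g (I k) := by
      rw [hgbar, smul_sum, smul_sum]
      refine sum_congr rfl fun k _ => ?_
      rw [smul_smul, smul_smul]
      congr 1
      rw [mul_inv, div_eq_mul_inv, mul_inv]
      ring
    have mean : ∑ i, r i • (α / (m * n) * (r i)⁻¹) • g i = (α / (m * n)) • G := by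
      rw [hG, smul_sum]
      refine sum_congr rfl fun i _ => ?_
      rw [smul_smul, mul_left_comm, mul_inv_cancel₀ (hr0 i).ne', mul_one]
    have second : ∑ i, r i * ‖(α / (m * n) * (r i)⁻¹) • g i‖ ^ 2 =
        (α / (m * n)) ^ 2 * ∑ i, (r i)⁻¹ * ‖g i‖ ^ 2 := by
      rw [mul_sum]
      refine sum_congr rfl fun i _ => ?_
      have := (hr0 i).ne'
      rw [norm_smul, mul_pow, Real.norm_eq_abs, sq_abs]
      field_simp
    simp_rw [hΔ, smul_gbar]
    rw [sum_prod_mul_norm_add_sum_sq r hr1 (fun i => (α / (m * n) * (r i)⁻¹) • g i), mean, second]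
    ring
  have hc : 0 < (m : ℝ) * (α / (m * n)) ^ 2 := by positivity
  rw [progress_eq p hp0 hp1, progress_eq q hq0 hq1, sub_le_sub_iff_left,
    mul_le_mul_iff_right₀ hc]
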